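/- (Sufficient ε-radius for BF to beat a Dawid–Skene prediction.) Assume b_j − ε_j ≤ (A η)_j ≤ b_j + ε_j for every j, let g^{bf} ∈ Δ_k^n attain sup_{g ∈ Δ_k^n} inf_{z ∈ P(b,ε)} z·log g, and suppose θ* ∈ ℝ^m satisfies A g^{(θ*)} = A η. Let g^{ds} = g^{ds}(w,β) be a one-coin Dawid–Skene prediction with 0 < w_ℓ < 1, Σ_ℓ w_ℓ = 1, and 0 < β_j < 1. If 2·(max_j ε_j)·(Σ_j |θ*_j|) ≤ d(η, g^{ds}) − d(η, g^{(θ*)}), then d(η, g^{bf}) ≤ d(η, g^{ds}). -/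

import Mathlib

open Finset

attribute [local instance] Classical.propDecidable

noncomputable section

/-- The simplex `Δ_k^n`: rows are probability distributions over `Fin k`. -/
def Simplex (n k : ℕ) : Set (Fin n → Fin k → ℝ) :=
  {z | (∀ i ℓ, 0 ≤ z i ℓ) ∧ ∀ i, ∑ ℓ, z i ℓ = 1}

/-- Number of points where rule `j` does not abstain. -/
def nRule {n k p : ℕ} (h : Fin p → Fin n → Option (Fin k)) (j : Fin p) : ℕ :=
  (Finset.univ.filter (fun i => h j i ≠ none)).card

/-- The constraint matrix `A`, with `m = p + k` rows indexed by `Fin p ⊕ Fin k`. -/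
def Amat {n k p : ℕ} (h : Fin p → Fin n → Option (Fin k)) :
    Fin p ⊕ Fin k → Fin n → Fin k → ℝ
  | Sum.inl j => fun i ℓ => if h j i = some ℓ then 1 / (nRule h j : ℝ) else 0
  | Sum.inr ℓ' => fun i ℓ => if ℓ = ℓ' then 1 / (n : ℝ) else 0

/-- `(A z)_j`. -/
def applyA {n k p : ℕ} (h : Fin p → Fin n → Option (Fin k))
    (z : Fin n → Fin k → ℝ) (j : Fin p ⊕ Fin k) : ℝ :=
  ∑ i, ∑ ℓ, Amat h j i ℓ * z i ℓ

/-- The polytope `P(b, ε)`. -/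
def Polytope {n k p : ℕ} (h : Fin p → Fin n → Option (Fin k))
    (b ε : Fin p ⊕ Fin k → ℝ) : Set (Fin n → Fin k → ℝ) :=
  {z | z ∈ Simplex n k ∧ ∀ j, b j - ε j ≤ applyA h z j ∧ applyA h z j ≤ b j + ε j}

/-- Extended-real logarithm, with `elog 0 = ⊥ = -∞`. -/
def elog (x : ℝ) : EReal := if x = 0 then ⊥ else ((Real.log x : ℝ) : EReal)

/-- `z · log g`, valued in `[-∞, 0]` with the convention `0 · log 0 = 0`. -/
def dotlog {n k : ℕ} (z g : Fin n → Fin k → ℝ) : EReal :=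
  ∑ i, ∑ ℓ, (z i ℓ : EReal) * elog (g i ℓ)

/-- `a^{(θ)}_{iℓ} = Σ_j θ_j · A j i ℓ`. -/
def avec {n k p : ℕ} (h : Fin p → Fin n → Option (Fin k))
    (θ : Fin p ⊕ Fin k → ℝ) (i : Fin n) (ℓ : Fin k) : ℝ :=
  ∑ j, θ j * Amat h j i ℓ

/-- The exponential-family (softmax) prediction `g^{(θ)}`. -/
def gexp {n k p : ℕ} (h : Fin p → Fin n → Option (Fin k))
    (θ : Fin p ⊕ Fin k → ℝ) (i : Fin n) (ℓ : Fin k) : ℝ :=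
  Real.exp (avec h θ i ℓ) / ∑ ℓ', Real.exp (avec h θ i ℓ')

/-- The BF dual objective `(σ'−σ)·b − (σ'+σ)·ε − Σ_i log(Σ_ℓ exp(a^{(σ'−σ)}_{iℓ}))`. -/
def dualObj {n k p : ℕ} (h : Fin p → Fin n → Option (Fin k))
    (b ε σ σ' : Fin p ⊕ Fin k → ℝ) : ℝ :=
  (∑ j, (σ' j - σ j) * b j) - (∑ j, (σ' j + σ j) * ε j)
    - ∑ i, Real.log (∑ ℓ, Real.exp (avec h (fun j => σ' j - σ j) i ℓ))

/-- KL summand `a·log(a/c)`, with `0·log(0/c) = 0` and `a·log(a/0) = ⊤` for `a ≠ 0`. -/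
def klTerm (a c : ℝ) : EReal :=
  if a = 0 then 0 else if c = 0 then ⊤ else ((a * Real.log (a / c) : ℝ) : EReal)

/-- `d(μ, ν)`, the summed KL divergences, valued in `[0, +∞]`. -/
def dKL {n k : ℕ} (μ ν : Fin n → Fin k → ℝ) : EReal :=
  ∑ i, ∑ ℓ, klTerm (μ i ℓ) (ν i ℓ)

/-- Unnormalized one-coin Dawid–Skene score `N_{iℓ}`. -/
def Nds {n k p : ℕ} (h : Fin p → Fin n → Option (Fin k))
    (w : Fin k → ℝ) (β : Fin p → ℝ) (i : Fin n) (ℓ : Fin k) : ℝ :=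
  w ℓ * (∏ j ∈ Finset.univ.filter (fun j => h j i = some ℓ), β j)
    * ∏ j ∈ Finset.univ.filter (fun j => ∃ ℓ' ≠ ℓ, h j i = some ℓ'),
        (1 - β j) / ((k : ℝ) - 1)

/-- The one-coin Dawid–Skene prediction `g^{ds}(w, β)`. -/
def gds {n k p : ℕ} (h : Fin p → Fin n → Option (Fin k))
    (w : Fin k → ℝ) (β : Fin p → ℝ) (i : Fin n) (ℓ : Fin k) : ℝ :=
  Nds h w β i ℓ / ∑ ℓ', Nds h w β i ℓ'

/-- If some entry has `z > 0` and `g = 0`, then `z · log g = -∞`. -/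
lemma dotlog_eq_bot {n k : ℕ} {z g : Fin n → Fin k → ℝ} {i : Fin n} {ℓ : Fin k}
    (hz : 0 < z i ℓ) (hg : g i ℓ = 0) : dotlog z g = ⊥ := by
  unfold dotlog
  refine (Finset.add_sum_erase _ _ (Finset.mem_univ i)).symm.trans ?_
  rw [← Finset.add_sum_erase _ _ (Finset.mem_univ ℓ)]
  simp [elog, hg, EReal.coe_mul_bot_of_pos hz]

lemma ereal_coe_sum_sum {n k : ℕ} (f : Fin n → Fin k → ℝ) :
    ((∑ i, ∑ ℓ, f i ℓ : ℝ) : EReal) = ∑ i, ∑ ℓ, (f i ℓ : EReal) := by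
  have coe_sum : ∀ {ι : Type} (s : Finset ι) (f : ι → ℝ),
      ((∑ i ∈ s, f i : ℝ) : EReal) = ∑ i ∈ s, (f i : EReal) := fun s f =>
    map_sum (⟨⟨Real.toEReal, EReal.coe_zero⟩, EReal.coe_add⟩ : ℝ →+ EReal) f s
  rw [coe_sum]
  exact Finset.sum_congr rfl fun i _ => coe_sum _ _

lemma dotlog_eq_coe {n k : ℕ} {z g : Fin n → Fin k → ℝ}
    (hzg : ∀ i ℓ, z i ℓ ≠ 0 → g i ℓ ≠ 0) :
    dotlog z g = ((∑ i, ∑ ℓ, z i ℓ * Real.log (g i ℓ) : ℝ) : EReal) := by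
  rw [ereal_coe_sum_sum]
  refine Finset.sum_congr rfl fun i _ => Finset.sum_congr rfl fun ℓ _ => ?_
  by_cases hz : z i ℓ = 0
  · simp [hz]
  · simp [elog, hzg i ℓ hz]

lemma dKL_eq_coe {n k : ℕ} {z g : Fin n → Fin k → ℝ}
    (hzg : ∀ i ℓ, z i ℓ ≠ 0 → g i ℓ ≠ 0) :
    dKL z g = (((∑ i, ∑ ℓ, z i ℓ * Real.log (z i ℓ))
      - ∑ i, ∑ ℓ, z i ℓ * Real.log (g i ℓ) : ℝ) : EReal) := by
  simp_rw [← Finset.sum_sub_distrib]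
  rw [ereal_coe_sum_sum]
  refine Finset.sum_congr rfl fun i _ => Finset.sum_congr rfl fun ℓ _ => ?_
  by_cases hz : z i ℓ = 0
  · simp [klTerm, hz]
  · rw [klTerm, if_neg hz, if_neg (hzg i ℓ hz), Real.log_div hz (hzg i ℓ hz), mul_sub]

section Softmax

variable {n k p : ℕ} (h : Fin p → Fin n → Option (Fin k)) (θ : Fin p ⊕ Fin k → ℝ)

lemma sum_exp_avec_pos (i : Fin n) (ℓ : Fin k) : 0 < ∑ ℓ', Real.exp (avec h θ i ℓ') :=
  Finset.sum_pos (fun _ _ => Real.exp_pos _) ⟨ℓ, Finset.mem_univ ℓ⟩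

lemma gexp_pos (i : Fin n) (ℓ : Fin k) : 0 < gexp h θ i ℓ :=
  div_pos (Real.exp_pos _) (sum_exp_avec_pos h θ i ℓ)

lemma gexp_mem_Simplex (hk : 0 < k) : gexp h θ ∈ Simplex n k := by
  refine ⟨fun i ℓ => (gexp_pos h θ i ℓ).le, fun i => ?_⟩
  simp only [gexp]
  rw [← Finset.sum_div, div_self (sum_exp_avec_pos h θ i ⟨0, hk⟩).ne']

lemma sum_mul_avec (z : Fin n → Fin k → ℝ) :
    ∑ i, ∑ ℓ, z i ℓ * avec h θ i ℓ = ∑ j, θ j * applyA h z j := by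
  simp only [avec, applyA, Finset.mul_sum]
  simp_rw [Finset.sum_comm (s := (Finset.univ : Finset (Fin k)))
    (t := (Finset.univ : Finset (Fin p ⊕ Fin k)))]
  rw [Finset.sum_comm]
  refine Finset.sum_congr rfl fun j _ => Finset.sum_congr rfl fun i _ =>
    Finset.sum_congr rfl fun ℓ _ => by ring

/-- The log-likelihood of `g^{(θ)}` depends on `z` only through `A z`. -/
lemma sum_mul_log_gexp {z : Fin n → Fin k → ℝ} (hz : z ∈ Simplex n k) :
    ∑ i, ∑ ℓ, z i ℓ * Real.log (gexp h θ i ℓ)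
      = (∑ j, θ j * applyA h z j) - ∑ i, Real.log (∑ ℓ, Real.exp (avec h θ i ℓ)) := by
  rw [← sum_mul_avec, ← Finset.sum_sub_distrib]
  refine Finset.sum_congr rfl fun i _ => ?_
  have key : ∀ ℓ, z i ℓ * Real.log (gexp h θ i ℓ) = z i ℓ * avec h θ i ℓ
      - z i ℓ * Real.log (∑ ℓ, Real.exp (avec h θ i ℓ)) := fun ℓ => by
    rw [gexp, Real.log_div (Real.exp_ne_zero _) (sum_exp_avec_pos h θ i ℓ).ne', Real.log_exp,
      mul_sub]
  simp_rw [key]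
  rw [Finset.sum_sub_distrib, ← Finset.sum_mul, hz.2 i, one_mul]

/-- Over `P(b, ε)`, the log-likelihood of `g^{(θ)}` varies by at most `2 (max ε) ‖θ‖₁`. -/
lemma sum_mul_log_gexp_sub_le {b ε : Fin p ⊕ Fin k → ℝ} {y z : Fin n → Fin k → ℝ}
    (hy : y ∈ Polytope h b ε) (hz : z ∈ Polytope h b ε) :
    (∑ i, ∑ ℓ, y i ℓ * Real.log (gexp h θ i ℓ)) - 2 * (⨆ j, ε j) * ∑ j, |θ j|
      ≤ ∑ i, ∑ ℓ, z i ℓ * Real.log (gexp h θ i ℓ) := by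
  rw [sum_mul_log_gexp h θ hy.1, sum_mul_log_gexp h θ hz.1]
  suffices H : (∑ j, θ j * applyA h y j) - ∑ j, θ j * applyA h z j
      ≤ 2 * (⨆ j, ε j) * ∑ j, |θ j| by linarith
  rw [← Finset.sum_sub_distrib, Finset.mul_sum]
  refine Finset.sum_le_sum fun j _ => ?_
  have hj : ε j ≤ ⨆ j, ε j := le_ciSup (Set.finite_range ε).bddAbove j
  obtain ⟨hy₁, hy₂⟩ := hy.2 j
  obtain ⟨hz₁, hz₂⟩ := hz.2 j
  rw [← mul_sub]
  refine (le_abs_self _).trans ?_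
  rw [abs_mul, mul_comm]
  refine mul_le_mul_of_nonneg_right ?_ (abs_nonneg _)
  rw [abs_le]
  constructor <;> linarith

end Softmax

/-- sufficient ε-radius for BF to beat a one-coin Dawid–Skene prediction. -/
theorem stmt16 {n k p : ℕ} (hn : 0 < n) (hk : 2 ≤ k) (hp : 0 < p)
    (h : Fin p → Fin n → Option (Fin k)) (hnj : ∀ j, 0 < nRule h j)
    (η : Fin n → Fin k → ℝ) (hη : η ∈ Simplex n k)
    (b ε : Fin p ⊕ Fin k → ℝ)
    (hmem : ∀ j, b j - ε j ≤ applyA h η j ∧ applyA h η j ≤ b j + ε j)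
    (gbf : Fin n → Fin k → ℝ) (hgbf : gbf ∈ Simplex n k)
    (hopt : (⨅ z ∈ Polytope h b ε, dotlog z gbf)
        = ⨆ g ∈ Simplex n k, ⨅ z ∈ Polytope h b ε, dotlog z g)
    (θstar : Fin p ⊕ Fin k → ℝ)
    (hmatch : ∀ j, applyA h (gexp h θstar) j = applyA h η j)
    (w : Fin k → ℝ) (β : Fin p → ℝ)
    (hw : ∀ ℓ, 0 < w ℓ ∧ w ℓ < 1) (hwsum : ∑ ℓ, w ℓ = 1)
    (hβ : ∀ j, 0 < β j ∧ β j < 1)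
    (hcond : ((2 * (⨆ j, ε j) * ∑ j, |θstar j| : ℝ) : EReal)
        ≤ dKL η (gds h w β) - dKL η (gexp h θstar)) :
    dKL η gbf ≤ dKL η (gds h w β) := by
  have hηP : η ∈ Polytope h b ε := ⟨hη, hmem⟩
  have hbf : (((∑ i, ∑ ℓ, η i ℓ * Real.log (gexp h θstar i ℓ))
      - 2 * (⨆ j, ε j) * ∑ j, |θstar j| : ℝ) : EReal) ≤ dotlog η gbf := by
    refine le_trans ?_ (iInf₂_le (f := fun z _ => dotlog z gbf) η hηP)
    rw [hopt]
    refine le_trans ?_ (le_iSup₂ (f := fun g (_ : g ∈ Simplex n k) =>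
      ⨅ z ∈ Polytope h b ε, dotlog z g) (gexp h θstar) (gexp_mem_Simplex h θstar (by omega)))
    refine le_iInf₂ fun z hz => ?_
    rw [dotlog_eq_coe fun i ℓ _ => (gexp_pos h θstar i ℓ).ne', EReal.coe_le_coe_iff]
    exact sum_mul_log_gexp_sub_le h θstar hηP hz
  have hsupp : ∀ i ℓ, η i ℓ ≠ 0 → gbf i ℓ ≠ 0 := fun i ℓ hne hg => by
    rw [dotlog_eq_bot ((hη.1 i ℓ).lt_of_ne' hne) hg] at hbf
    exact EReal.coe_ne_bot _ (le_bot_iff.1 hbf)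
  rw [dotlog_eq_coe hsupp, EReal.coe_le_coe_iff] at hbf
  rw [dKL_eq_coe fun i ℓ _ => (gexp_pos h θstar i ℓ).ne'] at hcond
  rw [dKL_eq_coe hsupp]
  generalize dKL η (gds h w β) = d at hcond ⊢
  induction d with
  | bot =>
    rw [EReal.bot_sub] at hcond
    exact absurd (le_bot_iff.1 hcond) (EReal.coe_ne_bot _)
  | top => exact le_top
  | coe D =>
    rw [← EReal.coe_sub, EReal.coe_le_coe_iff] at hcond
    rw [EReal.coe_le_coe_iff]
    linarith
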